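/- For every n ≥ 1, the map π from Γ_{n+1} to Γ_n deleting the last letter of a word is a 2-sheeted normal (Galois) covering of Schreier graphs of the Grigorchuk group with Galois group ℤ/2ℤ. Precisely: (i) π(s(w)) = s(π(w)) for every generator s ∈ {a,b,c,d} and every word w of length n+1; (ii) the last-letter flip σ (mapping u·x to u·(1−x)) satisfies s(σ(w)) = σ(s(w)) for every generator s and every word w of length n+1, so σ is a graph automorphism of Γ_{n+1}; (iii) σ∘σ = id, σ has no fixed point, π∘σ = π, and {id, σ} acts transitively on each fiber π⁻¹(u) = {u·0, u·1}. -/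

import Mathlib

/-- The generator `a` of the Grigorchuk group: `a(0w)=1w`, `a(1w)=0w`. -/
def grigA : List (Fin 2) → List (Fin 2)
  | [] => []
  | x :: w => (1 - x) :: w

mutual
/-- The generator `b`: `b(0w)=0·a(w)`, `b(1w)=1·c(w)`. -/
def grigB : List (Fin 2) → List (Fin 2)
  | [] => []
  | x :: w => if x = 0 then x :: grigA w else x :: grigC w
/-- The generator `c`: `c(0w)=0·a(w)`, `c(1w)=1·d(w)`. -/
def grigC : List (Fin 2) → List (Fin 2)
  | [] => []
  | x :: w => if x = 0 then x :: grigA w else x :: grigD w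
/-- The generator `d`: `d(0w)=0·w`, `d(1w)=1·b(w)`. -/
def grigD : List (Fin 2) → List (Fin 2)
  | [] => []
  | x :: w => if x = 0 then x :: w else x :: grigB w
end

/-- The last-letter flip `σ`, mapping `u·x` to `u·(1-x)`. -/
def flipLast (w : List (Fin 2)) : List (Fin 2) :=
  w.dropLast ++ [1 - w.getLastD 0]

/-- A map of binary words acts on the last letter by a translation depending only on the
preceding letters, and on these by the map itself. -/
def TranslatesLast (s : List (Fin 2) → List (Fin 2)) (u : List (Fin 2)) : Prop :=
  ∃ e : Fin 2, ∀ x : Fin 2, s (u ++ [x]) = s u ++ [x + e]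

theorem translatesLast_grigA (u : List (Fin 2)) : TranslatesLast grigA u := by
  cases u with
  | nil => exact ⟨1, by decide⟩
  | cons y u => exact ⟨0, fun x => by simp [grigA]⟩

theorem translatesLast_grigB_grigC_grigD (u : List (Fin 2)) :
    TranslatesLast grigB u ∧ TranslatesLast grigC u ∧ TranslatesLast grigD u := by
  induction u with
  | nil => exact ⟨⟨0, fun x => by simp [grigB, grigA, grigC]⟩,
      ⟨0, fun x => by simp [grigC, grigA, grigD]⟩, ⟨0, fun x => by simp [grigD, grigB]⟩⟩
  | cons y u ih =>
    obtain ⟨⟨eb, hb⟩, ⟨ec, hc⟩, ⟨ed, hd⟩⟩ := ih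
    obtain ⟨ea, ha⟩ := translatesLast_grigA u
    by_cases hy : y = 0
    · exact ⟨⟨ea, fun x => by simp [grigB, hy, ha]⟩, ⟨ea, fun x => by simp [grigC, hy, ha]⟩,
        ⟨0, fun x => by simp [grigD, hy]⟩⟩
    · exact ⟨⟨ec, fun x => by simp [grigB, hy, hc]⟩, ⟨ed, fun x => by simp [grigC, hy, hd]⟩,
        ⟨eb, fun x => by simp [grigD, hy, hb]⟩⟩

theorem translatesLast_of_mem {s : List (Fin 2) → List (Fin 2)}
    (hs : s ∈ [grigA, grigB, grigC, grigD]) (u : List (Fin 2)) : TranslatesLast s u := by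
  obtain ⟨hb, hc, hd⟩ := translatesLast_grigB_grigC_grigD u
  simp only [List.mem_cons, List.not_mem_nil, or_false] at hs
  rcases hs with rfl | rfl | rfl | rfl
  exacts [translatesLast_grigA u, hb, hc, hd]

theorem flipLast_append_singleton (u : List (Fin 2)) (x : Fin 2) :
    flipLast (u ++ [x]) = u ++ [1 - x] := by
  simp [flipLast]

theorem exists_eq_append_singleton {α : Type*} {n : ℕ} {w : List α} (hw : w.length = n + 1) :
    ∃ u x, w = u ++ [x] :=
  have hne : w ≠ [] := List.ne_nil_of_length_eq_add_one hw
  ⟨w.dropLast, w.getLast hne, (List.dropLast_append_getLast hne).symm⟩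

/-- For every `n ≥ 1`, deleting the last letter is a 2-sheeted normal (Galois) covering
`Γ_{n+1} → Γ_n` of Schreier graphs of the Grigorchuk group, with Galois group `ℤ/2ℤ`
generated by the last-letter flip `σ = flipLast`:
(i) it commutes with each generator; (ii) `σ` commutes with each generator, hence is a
graph automorphism of `Γ_{n+1}`; (iii) `σ∘σ = id`, `σ` has no fixed point, `π∘σ = π`,
the fiber over `u` is `{u·0, u·1}`, and `{id, σ}` acts transitively on each fiber. -/
theorem grigorchuk_galois_covering (n : ℕ) (hn : 1 ≤ n) :
    (∀ s ∈ [grigA, grigB, grigC, grigD], ∀ w : List (Fin 2), w.length = n + 1 →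
        (s w).dropLast = s w.dropLast) ∧
    (∀ s ∈ [grigA, grigB, grigC, grigD], ∀ w : List (Fin 2), w.length = n + 1 →
        s (flipLast w) = flipLast (s w)) ∧
    (∀ w : List (Fin 2), w.length = n + 1 → flipLast (flipLast w) = w) ∧
    (∀ w : List (Fin 2), w.length = n + 1 → flipLast w ≠ w) ∧
    (∀ w : List (Fin 2), w.length = n + 1 → (flipLast w).dropLast = w.dropLast) ∧
    (∀ u : List (Fin 2), u.length = n → ∀ w : List (Fin 2),
        (w.length = n + 1 ∧ w.dropLast = u) ↔ (w = u ++ [0] ∨ w = u ++ [1])) ∧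
    (∀ w w' : List (Fin 2), w.length = n + 1 → w'.length = n + 1 →
        w.dropLast = w'.dropLast → w' = w ∨ w' = flipLast w) := by
  refine ⟨fun s hs w hw => ?_, fun s hs w hw => ?_, fun w hw => ?_, fun w hw => ?_,
    fun w hw => ?_, fun u hu w => ⟨?_, ?_⟩, fun w w' hw hw' h => ?_⟩
  · obtain ⟨u, x, rfl⟩ := exists_eq_append_singleton hw
    obtain ⟨e, he⟩ := translatesLast_of_mem hs u
    simp [he]
  · obtain ⟨u, x, rfl⟩ := exists_eq_append_singleton hw
    obtain ⟨e, he⟩ := translatesLast_of_mem hs u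
    rw [flipLast_append_singleton, he, he, flipLast_append_singleton]
    congr 2
    clear he hw
    decide +revert
  · obtain ⟨u, x, rfl⟩ := exists_eq_append_singleton hw
    simp [flipLast_append_singleton]
  · obtain ⟨u, x, rfl⟩ := exists_eq_append_singleton hw
    have hx : 1 - x ≠ x := by clear hw; decide +revert
    simpa [flipLast_append_singleton] using hx
  · simp [flipLast]
  · rintro ⟨hw, hd⟩
    obtain ⟨v, x, rfl⟩ := exists_eq_append_singleton hw
    have hx : x = 0 ∨ x = 1 := by clear hw hd; decide +revert
    simp only [List.dropLast_concat] at hd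
    subst hd
    simpa using hx
  · rintro (rfl | rfl) <;> simp [hu]
  · obtain ⟨u, x, rfl⟩ := exists_eq_append_singleton hw
    obtain ⟨v, y, rfl⟩ := exists_eq_append_singleton hw'
    simp only [List.dropLast_concat] at h
    subst h
    have hxy : y = x ∨ y = 1 - x := by clear hw hw'; decide +revert
    simpa [flipLast_append_singleton] using hxy
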